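/- The number of Sp(D)-orbits on 'X_C × 'X_C (diagonal action) equals binomial(2n²+2n+d, d), and the number of Sp(D)-orbits on 'X_C × Y_C equals (2n+1)^d. -/

import Mathlib

noncomputable section

open Module

/-- The orthogonal complement of a subspace `W` with respect to a bilinear form `Q`. -/
def orthB {F M : Type} [Field F] [AddCommGroup M] [Module F M]
    (Q : M →ₗ[F] M →ₗ[F] F) (W : Submodule F M) : Submodule F M where
  carrier := {u | ∀ w ∈ W, Q u w = 0}
  add_mem' := by
    intro a b ha hb w hw
    simp [map_add, LinearMap.add_apply, ha w hw, hb w hw]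
  zero_mem' := by
    intro w hw
    simp
  smul_mem' := by
    intro c a ha w hw
    simp [map_smul, LinearMap.smul_apply, smul_eq_mul, ha w hw]

/-- `g` belongs to the isometry group of `Q` (for skew-symmetric nondegenerate `Q` on
`𝔽_q^D`, `D = 2d`, this is the symplectic group `Sp(D)`). -/
def inIsom {F M : Type} [Field F] [AddCommGroup M] [Module F M]
    (Q : M →ₗ[F] M →ₗ[F] F) (g : M ≃ₗ[F] M) : Prop :=
  ∀ u u', Q (g u) (g u') = Q u u'

/-- A point of `'X_C`: an `N`-step flag (`N = 2n+1`) in `𝔽_q^D` (`D = 2d`) with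
`V_i = V_{N−i}^⊥` for all `i`. -/
def XCflag (n d : ℕ) (F : Type) [Field F]
    (Q : (Fin (2*d) → F) →ₗ[F] (Fin (2*d) → F) →ₗ[F] F) : Type :=
  {V : Fin (2*n+1+1) → Submodule F (Fin (2*d) → F) //
    Monotone V ∧ V 0 = ⊥ ∧ V (Fin.last (2*n+1)) = ⊤ ∧ ∀ i, V i = orthB Q (V i.rev)}

/-- A point of `Y_C`: a complete flag in `𝔽_q^D` (`D = 2d`) with `dim Fl_i = i` and
`Fl_i = Fl_{D−i}^⊥` for all `i`. -/
def YCflag (d : ℕ) (F : Type) [Field F]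
    (Q : (Fin (2*d) → F) →ₗ[F] (Fin (2*d) → F) →ₗ[F] F) : Type :=
  {Fl : Fin (2*d+1) → Submodule F (Fin (2*d) → F) //
    Monotone Fl ∧ Fl 0 = ⊥ ∧ Fl (Fin.last (2*d)) = ⊤
      ∧ (∀ i, finrank F (Fl i) = (i : ℕ)) ∧ ∀ i, Fl i = orthB Q (Fl i.rev)}

/-- The `Sp(D)`-orbit equivalence on `'X_C × 'X_C` (diagonal action). -/
def relXX (n d : ℕ) (F : Type) [Field F]
    (Q : (Fin (2*d) → F) →ₗ[F] (Fin (2*d) → F) →ₗ[F] F)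
    (p p' : XCflag n d F Q × XCflag n d F Q) : Prop :=
  ∃ g : (Fin (2*d) → F) ≃ₗ[F] (Fin (2*d) → F), inIsom Q g
    ∧ (∀ i, (p.1.1 i).map (g : (Fin (2*d) → F) →ₗ[F] (Fin (2*d) → F)) = p'.1.1 i)
    ∧ (∀ i, (p.2.1 i).map (g : (Fin (2*d) → F) →ₗ[F] (Fin (2*d) → F)) = p'.2.1 i)

/-- The `Sp(D)`-orbit equivalence on `'X_C × Y_C` (diagonal action). -/
def relXY (n d : ℕ) (F : Type) [Field F]
    (Q : (Fin (2*d) → F) →ₗ[F] (Fin (2*d) → F) →ₗ[F] F)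
    (p p' : XCflag n d F Q × YCflag d F Q) : Prop :=
  ∃ g : (Fin (2*d) → F) ≃ₗ[F] (Fin (2*d) → F), inIsom Q g
    ∧ (∀ i, (p.1.1 i).map (g : (Fin (2*d) → F) →ₗ[F] (Fin (2*d) → F)) = p'.1.1 i)
    ∧ (∀ i, (p.2.1 i).map (g : (Fin (2*d) → F) →ₗ[F] (Fin (2*d) → F)) = p'.2.1 i)

/-! ### Counting lemmas -/

theorem Nat.card_eq_of_surjective_of_ker_eq {A X Y : Type*} (f : A → X) (g : A → Y)
    (hf : Function.Surjective f) (hg : Function.Surjective g)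
    (h : ∀ a b, f a = f b ↔ g a = g b) : Nat.card X = Nat.card Y := by
  have hker : Setoid.ker f = Setoid.ker g := by
    ext a b
    exact h a b
  have e₁ := Setoid.quotientKerEquivOfSurjective f hf
  rw [hker] at e₁
  exact Nat.card_congr (e₁.symm.trans (Setoid.quotientKerEquivOfSurjective g hg))

theorem exists_perm_of_card_fiber_eq {ι T : Type*} [Fintype ι] [DecidableEq T] (f g : ι → T)
    (h : ∀ t, (Finset.univ.filter fun k => f k = t).card
      = (Finset.univ.filter fun k => g k = t).card) :
    ∃ π : Equiv.Perm ι, ∀ k, g (π k) = f k := by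
  have hfib : ∀ t, Nonempty ({k // f k = t} ≃ {k // g k = t}) := fun t =>
    Fintype.card_eq.mp (by rw [Fintype.card_subtype, Fintype.card_subtype, h t])
  exact ⟨Equiv.ofFiberEquiv fun t => (hfib t).some, fun k => Equiv.ofFiberEquiv_map _ k⟩

theorem Fin.exists_step {N : ℕ} (p : Fin (N + 1) → Prop) (h₀ : ¬ p 0) (h₁ : p (Fin.last N)) :
    ∃ a : Fin N, ¬ p a.castSucc ∧ p a.succ := by
  by_contra! h
  exact Fin.induction (motive := fun i => ¬ p i) h₀ (fun a ha => h a ha) (Fin.last N) h₁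

/-- Counting a fibre of a function to a grid from the counts over initial rectangles. -/
theorem card_fiber_eq_of_card_rect_eq {ι : Type*} [Fintype ι] {N N' : ℕ}
    (g g' : ι → Fin N × Fin N')
    (h : ∀ (i : Fin (N + 1)) (i' : Fin (N' + 1)),
      (Finset.univ.filter fun j => (g j).1.castSucc < i ∧ (g j).2.castSucc < i').card
        = (Finset.univ.filter fun j => (g' j).1.castSucc < i ∧ (g' j).2.castSucc < i').card)
    (p : Fin N × Fin N') :
    (Finset.univ.filter fun j => g j = p).card = (Finset.univ.filter fun j => g' j = p).card := by
  have key : ∀ f : ι → Fin N × Fin N',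
      (Finset.univ.filter fun j => f j = p).card
        + (Finset.univ.filter fun j =>
            (f j).1.castSucc < p.1.castSucc ∧ (f j).2.castSucc < p.2.succ).card
        + (Finset.univ.filter fun j =>
            (f j).1.castSucc < p.1.succ ∧ (f j).2.castSucc < p.2.castSucc).card
      = (Finset.univ.filter fun j =>
            (f j).1.castSucc < p.1.succ ∧ (f j).2.castSucc < p.2.succ).card
        + (Finset.univ.filter fun j =>
            (f j).1.castSucc < p.1.castSucc ∧ (f j).2.castSucc < p.2.castSucc).card := by
    intro f
    simp only [Finset.card_filter, ← Finset.sum_add_distrib]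
    refine Finset.sum_congr rfl fun j _ => ?_
    simp only [Prod.ext_iff, Fin.ext_iff, Fin.lt_def, Fin.val_castSucc, Fin.val_succ]
    split_ifs <;> omega
  have h₁ := key g
  have h₂ := key g'
  rw [h, h, h, h] at h₁
  omega

/-! ### Hyperbolic systems -/

section Hyperbolic

variable {F M : Type} [Field F] [AddCommGroup M] [Module F M]

/-- The sign attached to a member of a hyperbolic pair. -/
def pairSign (F : Type) [Field F] (b : Bool) : F := if b then -1 else 1

/-- The index of the hyperbolic partner. -/
def partner {r : ℕ} (j : Fin r × Bool) : Fin r × Bool := (j.1, !j.2)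

/-- `Fin.rev`, switched by a boolean. -/
def revIf {N : ℕ} (b : Bool) (a : Fin N) : Fin N := if b then a.rev else a

@[simp] theorem partner_partner {r : ℕ} (j : Fin r × Bool) : partner (partner j) = j := by
  simp [partner]

theorem pairSign_mul_self (b : Bool) : pairSign F b * pairSign F b = 1 := by
  cases b <;> simp [pairSign]

theorem revIf_not {N : ℕ} (b : Bool) (a : Fin N) : revIf (!b) a = (revIf b a).rev := by
  cases b <;> simp [revIf]

/-- A family of mutually orthogonal hyperbolic pairs `(e (k, false), e (k, true))`. -/
def HypSystem (Q : M →ₗ[F] M →ₗ[F] F) {r : ℕ} (e : Fin r × Bool → M) : Prop :=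
  ∀ i j, Q (e i) (e j) = if j = partner i then pairSign F i.2 else 0

/-- The projection onto the span of a hyperbolic system. -/
def hypProj (Q : M →ₗ[F] M →ₗ[F] F) {r : ℕ} (e : Fin r × Bool → M) (v : M) : M :=
  ∑ j, (pairSign F j.2 * Q v (e (partner j))) • e j

/-- Self-dual flags. -/
structure SelfDualFlag (Q : M →ₗ[F] M →ₗ[F] F) {N : ℕ} (V : Fin (N + 1) → Submodule F M) :
    Prop where
  mono : Monotone V
  zero : V 0 = ⊥
  last : V (Fin.last N) = ⊤
  dual : ∀ i, V i = orthB Q (V i.rev)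

/-- Each vector of the system lies in the step of the flag prescribed by `c`. -/
def Adapted {r N : ℕ} (V : Fin (N + 1) → Submodule F M) (e : Fin r × Bool → M)
    (c : Fin r → Fin N) : Prop :=
  ∀ j, e j ∈ V (revIf j.2 (c j.1)).succ

variable {Q : M →ₗ[F] M →ₗ[F] F}

theorem mem_orthB {W : Submodule F M} {u : M} : u ∈ orthB Q W ↔ ∀ w ∈ W, Q u w = 0 := Iff.rfl

theorem HypSystem.hypProj_apply {r : ℕ} {e : Fin r × Bool → M} (he : HypSystem Q e) (v : M)
    (l : Fin r × Bool) : Q (hypProj Q e v) (e l) = Q v (e l) := by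
  rw [hypProj, map_sum, LinearMap.sum_apply, Finset.sum_eq_single (partner l)]
  · rw [map_smul, LinearMap.smul_apply, he, partner_partner, if_pos rfl, smul_eq_mul,
      mul_right_comm, pairSign_mul_self, one_mul]
  · intro j _ hj
    rw [map_smul, LinearMap.smul_apply, he, if_neg, smul_zero]
    rintro rfl
    simp at hj
  · simp

theorem HypSystem.linearIndependent {r : ℕ} {e : Fin r × Bool → M} (he : HypSystem Q e) :
    LinearIndependent F e := by
  rw [Fintype.linearIndependent_iff]
  intro a ha i
  have h : Q (∑ j, a j • e j) (e (partner i)) = 0 := by rw [ha]; simp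
  rw [map_sum, LinearMap.sum_apply, Finset.sum_eq_single i] at h
  · rw [map_smul, LinearMap.smul_apply, he, if_pos rfl, smul_eq_mul] at h
    have : a i * pairSign F i.2 * pairSign F i.2 = 0 := by rw [h, zero_mul]
    rwa [mul_assoc, pairSign_mul_self, mul_one] at this
  · intro j _ hj
    rw [map_smul, LinearMap.smul_apply, he, if_neg, smul_zero]
    intro h'
    apply hj
    rw [← partner_partner i, h', partner_partner]
  · simp

theorem Adapted.mem_of_lt {r N : ℕ} {V : Fin (N + 1) → Submodule F M} (hV : SelfDualFlag Q V)
    {e : Fin r × Bool → M} {c : Fin r → Fin N} (h : Adapted V e c) {j : Fin r × Bool}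
    {i : Fin (N + 1)} (hi : (revIf j.2 (c j.1)).castSucc < i) : e j ∈ V i :=
  hV.mono (Fin.castSucc_lt_iff_succ_le.mp hi) (h j)

theorem Adapted.apply_partner_eq_zero {r N : ℕ} {V : Fin (N + 1) → Submodule F M}
    (hskew : ∀ u u', Q u u' = - Q u' u) (hV : SelfDualFlag Q V)
    {e : Fin r × Bool → M} {c : Fin r → Fin N} (h : Adapted V e c) {j : Fin r × Bool}
    {i : Fin (N + 1)} (hi : i ≤ (revIf j.2 (c j.1)).castSucc) {v : M} (hv : v ∈ V i) :
    Q v (e (partner j)) = 0 := by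
  have hj := h (partner j)
  rw [partner, revIf_not, ← Fin.rev_castSucc, hV.dual, Fin.rev_rev] at hj
  rw [hskew, neg_eq_zero]
  exact hj v (hV.mono hi hv)

theorem Adapted.hypProj_mem {r N : ℕ} {V : Fin (N + 1) → Submodule F M}
    (hskew : ∀ u u', Q u u' = - Q u' u) (hV : SelfDualFlag Q V)
    {e : Fin r × Bool → M} {c : Fin r → Fin N} (h : Adapted V e c)
    {i : Fin (N + 1)} {v : M} (hv : v ∈ V i) : hypProj Q e v ∈ V i := by
  refine Submodule.sum_mem _ fun j _ => ?_
  by_cases hi : (revIf j.2 (c j.1)).castSucc < i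
  · exact Submodule.smul_mem _ _ (h.mem_of_lt hV hi)
  · rw [h.apply_partner_eq_zero hskew hV (not_lt.mp hi) hv, mul_zero, zero_smul]
    exact Submodule.zero_mem _

/-- The vectors orthogonal to every member of a family. -/
def familyOrth (Q : M →ₗ[F] M →ₗ[F] F) {r : ℕ} (e : Fin r × Bool → M) : Submodule F M :=
  orthB Q (Submodule.span F (Set.range e))

theorem mem_familyOrth {r : ℕ} {e : Fin r × Bool → M} {u : M} :
    u ∈ familyOrth Q e ↔ ∀ j, Q u (e j) = 0 := by
  refine ⟨fun h j => h _ (Submodule.subset_span ⟨j, rfl⟩), fun h w hw => ?_⟩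
  have : Submodule.span F (Set.range e) ≤ LinearMap.ker (Q u) := by
    rw [Submodule.span_le]
    rintro _ ⟨j, rfl⟩
    exact h j
  exact this hw

theorem HypSystem.sub_hypProj_mem {r : ℕ} {e : Fin r × Bool → M} (he : HypSystem Q e) (v : M) :
    v - hypProj Q e v ∈ familyOrth Q e := by
  rw [mem_familyOrth]
  intro j
  rw [map_sub, LinearMap.sub_apply, he.hypProj_apply, sub_self]

theorem hypProj_mem_span {r : ℕ} {e : Fin r × Bool → M} (v : M) :
    hypProj Q e v ∈ Submodule.span F (Set.range e) :=
  Submodule.sum_mem _ fun j _ => Submodule.smul_mem _ _ (Submodule.subset_span ⟨j, rfl⟩)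

/-- Adjoin a pair of vectors to a family of pairs. -/
def consPair {r : ℕ} (x y : M) (e : Fin r × Bool → M) : Fin (r + 1) × Bool → M :=
  fun j => Fin.cases (if j.2 then y else x) (fun k => e (k, j.2)) j.1

theorem HypSystem.consPair {r : ℕ} {e : Fin r × Bool → M} (he : HypSystem Q e)
    (hskew : ∀ u u', Q u u' = - Q u' u) (halt : ∀ u, Q u u = 0) {x y : M}
    (hx : x ∈ familyOrth Q e) (hy : y ∈ familyOrth Q e) (hxy : Q x y = 1) :
    HypSystem Q (consPair x y e) := by
  rw [mem_familyOrth] at hx hy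
  have hx' : ∀ j, Q (e j) x = 0 := fun j => by rw [hskew, hx, neg_zero]
  have hy' : ∀ j, Q (e j) y = 0 := fun j => by rw [hskew, hy, neg_zero]
  have hyx : Q y x = -1 := by rw [hskew, hxy]
  rintro ⟨k, b⟩ ⟨l, b'⟩
  refine Fin.cases ?_ (fun k => ?_) k <;> refine Fin.cases ?_ (fun l => ?_) l
  · cases b <;> cases b' <;> simp [_root_.consPair, partner, pairSign, halt, hxy, hyx]
  · cases b <;> simp [_root_.consPair, partner, hx, hy, Fin.succ_ne_zero]
  · cases b' <;> simp [_root_.consPair, partner, hx', hy', (Fin.succ_ne_zero _).symm]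
  · simp only [_root_.consPair, Fin.cases_succ]
    rw [he]
    simp [partner]

theorem Adapted.consPair {r N : ℕ} {V : Fin (N + 1) → Submodule F M} {e : Fin r × Bool → M}
    {c : Fin r → Fin N} (h : Adapted V e c) {a : Fin N} {x y : M} (hx : x ∈ V a.succ)
    (hy : y ∈ V a.rev.succ) : Adapted V (consPair x y e) (Fin.cons a c) := by
  rintro ⟨k, b⟩
  refine Fin.cases ?_ (fun k => ?_) k
  · cases b <;> simpa [_root_.consPair, revIf]
  · simpa [_root_.consPair] using h (k, b)

theorem exists_adapted_extension {r N N' : ℕ} (hskew : ∀ u u', Q u u' = - Q u' u)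
    {V : Fin (N + 1) → Submodule F M} {V' : Fin (N' + 1) → Submodule F M}
    (hV : SelfDualFlag Q V) (hV' : SelfDualFlag Q V')
    {e : Fin r × Bool → M} (he : HypSystem Q e) {c : Fin r → Fin N} {c' : Fin r → Fin N'}
    (hc : Adapted V e c) (hc' : Adapted V' e c') (hU : familyOrth Q e ≠ ⊥) :
    ∃ x y : M, ∃ a : Fin N, ∃ a' : Fin N', x ∈ familyOrth Q e ∧ y ∈ familyOrth Q e ∧ Q x y = 1 ∧
      x ∈ V a.succ ∧ y ∈ V a.rev.succ ∧ x ∈ V' a'.succ ∧ y ∈ V' a'.rev.succ := by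
  obtain ⟨a, ha₀, ha₁⟩ := Fin.exists_step (fun i => V i ⊓ familyOrth Q e ≠ ⊥)
    (by simp [hV.zero]) (by simpa [hV.last] using hU)
  obtain ⟨a', ha'₀, ha'₁⟩ := Fin.exists_step (fun i => V' i ⊓ (V a.succ ⊓ familyOrth Q e) ≠ ⊥)
    (by simp [hV'.zero]) (by simpa [hV'.last] using ha₁)
  rw [not_not] at ha₀ ha'₀
  obtain ⟨x, ⟨hx', hx, hxU⟩, hx0⟩ := Submodule.exists_mem_ne_zero_of_ne_bot ha'₁
  have hxn : x ∉ V' a'.castSucc := by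
    intro h
    apply hx0
    have : x ∈ V' a'.castSucc ⊓ (V a.succ ⊓ familyOrth Q e) := ⟨h, hx, hxU⟩
    rwa [ha'₀, Submodule.mem_bot] at this
  rw [hV'.dual, mem_orthB, Fin.rev_castSucc] at hxn
  push Not at hxn
  obtain ⟨z, hz, hxz⟩ := hxn
  set w := z - hypProj Q e z with hw
  have hwU : w ∈ familyOrth Q e := he.sub_hypProj_mem z
  have hxw : Q x w = Q x z := by
    rw [hw, map_sub, mem_orthB.mp hxU _ (hypProj_mem_span z), sub_zero]
  have hwV' : w ∈ V' a'.rev.succ := Submodule.sub_mem _ hz (hc'.hypProj_mem hskew hV' hz)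
  have hwV : w ∈ V a.rev.succ := by
    rw [← Fin.rev_castSucc, hV.dual, Fin.rev_rev, mem_orthB]
    intro t ht
    have h₀ : t - hypProj Q e t ∈ V a.castSucc ⊓ familyOrth Q e :=
      ⟨Submodule.sub_mem _ ht (hc.hypProj_mem hskew hV ht), he.sub_hypProj_mem t⟩
    rw [ha₀, Submodule.mem_bot, sub_eq_zero] at h₀
    rw [h₀]
    exact hwU _ (hypProj_mem_span t)
  refine ⟨x, (Q x z)⁻¹ • w, a, a', hxU, Submodule.smul_mem _ _ hwU, ?_, hx,
    Submodule.smul_mem _ _ hwV, hx', Submodule.smul_mem _ _ hwV'⟩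
  rw [map_smul, hxw, smul_eq_mul, inv_mul_cancel₀ hxz]

theorem exists_adapted_of_le {d N N' : ℕ} (hM : finrank F M = 2 * d)
    (hskew : ∀ u u', Q u u' = - Q u' u) (halt : ∀ u, Q u u = 0)
    {V : Fin (N + 1) → Submodule F M} {V' : Fin (N' + 1) → Submodule F M}
    (hV : SelfDualFlag Q V) (hV' : SelfDualFlag Q V') (r : ℕ) (hr : r ≤ d) :
    ∃ (e : Fin r × Bool → M) (c : Fin r → Fin N) (c' : Fin r → Fin N'),
      HypSystem Q e ∧ Adapted V e c ∧ Adapted V' e c' := by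
  induction r with
  | zero =>
    exact ⟨fun j => j.1.elim0, fun k => k.elim0, fun k => k.elim0, fun j => j.1.elim0,
      fun j => j.1.elim0, fun j => j.1.elim0⟩
  | succ r ih =>
    obtain ⟨e, c, c', he, hc, hc'⟩ := ih (by omega)
    have hspan : Submodule.span F (Set.range e) ≠ ⊤ := by
      intro h
      have h₁ := finrank_span_eq_card he.linearIndependent
      rw [h, finrank_top, hM] at h₁
      simp at h₁
      omega
    obtain ⟨v, hv⟩ : ∃ v, v ∉ Submodule.span F (Set.range e) := by
      by_contra! h
      exact hspan (eq_top_iff.mpr fun v _ => h v)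
    have hU : familyOrth Q e ≠ ⊥ := by
      intro h
      have h₀ := he.sub_hypProj_mem v
      rw [h, Submodule.mem_bot, sub_eq_zero] at h₀
      exact hv (h₀ ▸ hypProj_mem_span v)
    obtain ⟨x, y, a, a', hxU, hyU, hxy, hx, hy, hx', hy'⟩ :=
      exists_adapted_extension hskew hV hV' he hc hc' hU
    exact ⟨consPair x y e, Fin.cons a c, Fin.cons a' c', he.consPair hskew halt hxU hyU hxy,
      hc.consPair hx hy, hc'.consPair hx' hy'⟩

theorem HypSystem.span_eq_top {d : ℕ} (hM : finrank F M = 2 * d) [FiniteDimensional F M]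
    {e : Fin d × Bool → M} (he : HypSystem Q e) :
    Submodule.span F (Set.range e) = ⊤ :=
  he.linearIndependent.span_eq_top_of_card_eq_finrank' (by simp [hM, mul_comm])

/-- The basis given by a hyperbolic system of full size. -/
def HypSystem.basis {d : ℕ} (hM : finrank F M = 2 * d) [FiniteDimensional F M]
    {e : Fin d × Bool → M} (he : HypSystem Q e) : Basis (Fin d × Bool) F M :=
  Basis.mk he.linearIndependent (he.span_eq_top hM).ge

theorem HypSystem.coe_basis {d : ℕ} (hM : finrank F M = 2 * d) [FiniteDimensional F M]
    {e : Fin d × Bool → M} (he : HypSystem Q e) : ⇑(he.basis hM) = e :=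
  Basis.coe_mk _ _

theorem HypSystem.basis_repr {d : ℕ} (hM : finrank F M = 2 * d) [FiniteDimensional F M]
    {e : Fin d × Bool → M} (he : HypSystem Q e) (v : M) (j : Fin d × Bool) :
    (he.basis hM).repr v j = pairSign F j.2 * Q v (e (partner j)) := by
  conv_rhs => rw [← (he.basis hM).sum_repr v]
  rw [map_sum, LinearMap.sum_apply, Finset.sum_eq_single j]
  · rw [he.coe_basis hM, map_smul, LinearMap.smul_apply, he, if_pos rfl, smul_eq_mul,
      mul_left_comm, pairSign_mul_self, mul_one]
  · intro i _ hi
    rw [he.coe_basis hM, map_smul, LinearMap.smul_apply, he, if_neg, smul_zero]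
    intro h'
    apply hi
    rw [← partner_partner j, h', partner_partner]
  · simp

/-- The coordinate flag with positions `c` in a hyperbolic system. -/
def coordFlag {d N : ℕ} (e : Fin d × Bool → M) (c : Fin d → Fin N) (i : Fin (N + 1)) :
    Submodule F M :=
  Submodule.span F (e '' {j | (revIf j.2 (c j.1)).castSucc < i})

theorem HypSystem.mem_span_image {d : ℕ} (hM : finrank F M = 2 * d) [FiniteDimensional F M]
    {e : Fin d × Bool → M} (he : HypSystem Q e) (s : Set (Fin d × Bool)) (v : M) :
    v ∈ Submodule.span F (e '' s) ↔ ∀ j, j ∉ s → Q v (e (partner j)) = 0 := by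
  have h := (he.basis hM).mem_span_image (m := v) (s := s)
  rw [he.coe_basis hM] at h
  rw [h]
  have hs : ∀ j, pairSign F j.2 * Q v (e (partner j)) = 0 ↔ Q v (e (partner j)) = 0 := by
    intro j
    rw [mul_eq_zero, or_iff_right]
    intro h0
    have := pairSign_mul_self (F := F) j.2
    simp [h0] at this
  constructor
  · intro hsub j hj
    rw [← hs, ← he.basis_repr hM]
    by_contra hne
    exact hj (hsub (Finsupp.mem_support_iff.mpr hne))
  · intro h0 j hj
    by_contra hjs
    have := Finsupp.mem_support_iff.mp hj
    rw [he.basis_repr hM, Ne, hs] at this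
    exact this (h0 j hjs)

theorem Adapted.eq_coordFlag {d N : ℕ} (hM : finrank F M = 2 * d) [FiniteDimensional F M]
    (hskew : ∀ u u', Q u u' = - Q u' u)
    {V : Fin (N + 1) → Submodule F M} (hV : SelfDualFlag Q V)
    {e : Fin d × Bool → M} (he : HypSystem Q e) {c : Fin d → Fin N} (h : Adapted V e c)
    (i : Fin (N + 1)) : V i = coordFlag e c i := by
  apply le_antisymm
  · intro v hv
    rw [coordFlag, he.mem_span_image hM]
    intro j hj
    exact h.apply_partner_eq_zero hskew hV (not_lt.mp hj) hv
  · rw [coordFlag, Submodule.span_le]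
    rintro _ ⟨j, hj, rfl⟩
    exact h.mem_of_lt hV hj

theorem adapted_coordFlag {d N : ℕ} (e : Fin d × Bool → M) (c : Fin d → Fin N) :
    Adapted (F := F) (coordFlag e c) e c := fun j =>
  Submodule.subset_span ⟨j, Fin.castSucc_lt_succ, rfl⟩

theorem selfDualFlag_coordFlag {d N : ℕ} (hM : finrank F M = 2 * d) [FiniteDimensional F M]
    {e : Fin d × Bool → M} (he : HypSystem Q e) (c : Fin d → Fin N) :
    SelfDualFlag Q (coordFlag e c) where
  mono i i' h := Submodule.span_mono (Set.image_mono fun _ hj => lt_of_lt_of_le hj h)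
  zero := by simp [coordFlag]
  last := by
    rw [coordFlag, eq_top_iff, ← he.span_eq_top hM]
    refine Submodule.span_mono ?_
    rintro _ ⟨j, rfl⟩
    exact ⟨j, Fin.castSucc_lt_last _, rfl⟩
  dual i := by
    ext v
    have hiff : v ∈ orthB Q (coordFlag e c i.rev) ↔
        ∀ j, (revIf j.2 (c j.1)).castSucc < i.rev → Q v (e j) = 0 := by
      refine ⟨fun h j hj => h _ (Submodule.subset_span ⟨j, hj, rfl⟩), fun h w hw => ?_⟩
      have : coordFlag e c i.rev ≤ LinearMap.ker (Q v) := by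
        rw [coordFlag, Submodule.span_le]
        rintro _ ⟨j, hj, rfl⟩
        exact h j hj
      exact this hw
    have hlt : ∀ j : Fin d × Bool, ¬ (revIf j.2 (c j.1)).castSucc < i ↔
        (revIf (partner j).2 (c (partner j).1)).castSucc < i.rev := by
      intro j
      simp only [partner, revIf_not, Fin.lt_def, Fin.val_castSucc, Fin.val_rev]
      omega
    rw [hiff, coordFlag, he.mem_span_image hM]
    constructor
    · intro h j hj
      have := h (partner j) ((hlt _).mpr (by rwa [partner_partner]))
      rwa [partner_partner] at this
    · intro h j hj
      exact h _ ((hlt j).mp hj)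

theorem finrank_coordFlag_inf {d N N' : ℕ} (hM : finrank F M = 2 * d) [FiniteDimensional F M]
    {e : Fin d × Bool → M} (he : HypSystem Q e) (c : Fin d → Fin N) (c' : Fin d → Fin N')
    (i : Fin (N + 1)) (i' : Fin (N' + 1)) :
    finrank F ↥(coordFlag (F := F) e c i ⊓ coordFlag e c' i') =
      (Finset.univ.filter fun j : Fin d × Bool => (revIf j.2 (c j.1)).castSucc < i ∧
        (revIf j.2 (c' j.1)).castSucc < i').card := by
  have h : coordFlag (F := F) e c i ⊓ coordFlag e c' i' =
      Submodule.span F (Set.range fun j : {j : Fin d × Bool // (revIf j.2 (c j.1)).castSucc < i ∧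
        (revIf j.2 (c' j.1)).castSucc < i'} => e j) := by
    have hr : (Set.range fun j : {j : Fin d × Bool // (revIf j.2 (c j.1)).castSucc < i ∧
        (revIf j.2 (c' j.1)).castSucc < i'} => e j) =
        e '' {j | (revIf j.2 (c j.1)).castSucc < i ∧ (revIf j.2 (c' j.1)).castSucc < i'} := by
      ext v
      simp
    rw [hr]
    ext v
    rw [Submodule.mem_inf, coordFlag, coordFlag, he.mem_span_image hM, he.mem_span_image hM,
      he.mem_span_image hM]
    simp only [Set.mem_ofPred_eq, not_and_or]
    exact ⟨fun h j hj => hj.elim (h.1 j) (h.2 j),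
      fun h => ⟨fun j hj => h j (Or.inl hj), fun j hj => h j (Or.inr hj)⟩⟩
  rw [h]
  exact (finrank_span_eq_card (he.linearIndependent.comp _ Subtype.val_injective)).trans
    (Fintype.card_subtype _)

theorem finrank_coordFlag {d N : ℕ} (hM : finrank F M = 2 * d) [FiniteDimensional F M]
    {e : Fin d × Bool → M} (he : HypSystem Q e) (c : Fin d → Fin N) (i : Fin (N + 1)) :
    finrank F ↥(coordFlag (F := F) e c i) =
      (Finset.univ.filter fun j : Fin d × Bool => (revIf j.2 (c j.1)).castSucc < i).card := by
  have h := finrank_coordFlag_inf hM he c c i i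
  rw [inf_idem] at h
  simpa only [and_self] using h

/-- The isometry carrying one full hyperbolic system to another. -/
theorem HypSystem.exists_isom {d : ℕ} (hM : finrank F M = 2 * d) [FiniteDimensional F M]
    {e e' : Fin d × Bool → M} (he : HypSystem Q e) (he' : HypSystem Q e') :
    ∃ g : M ≃ₗ[F] M, inIsom Q g ∧ ∀ j, g (e j) = e' j := by
  have hg : ∀ j, (he.basis hM).equiv (he'.basis hM) (Equiv.refl _) (e j) = e' j := by
    intro j
    have h := (he.basis hM).equiv_apply (b' := he'.basis hM) (e := Equiv.refl _) j
    rwa [he.coe_basis hM, he'.coe_basis hM] at h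
  refine ⟨_, ?_, hg⟩
  set g := (he.basis hM).equiv (he'.basis hM) (Equiv.refl _)
  have h : Q.compl₁₂ (g : M →ₗ[F] M) (g : M →ₗ[F] M) = Q := by
    refine LinearMap.ext_basis (he.basis hM) (he.basis hM) fun i j => ?_
    rw [he.coe_basis hM, LinearMap.compl₁₂_apply, LinearEquiv.coe_coe, hg, hg, he, he']
  intro u u'
  exact LinearMap.congr_fun (LinearMap.congr_fun h u) u'

theorem map_coordFlag {d N : ℕ} {e e' : Fin d × Bool → M} (g : M →ₗ[F] M)
    (hg : ∀ j, g (e j) = e' j) (c : Fin d → Fin N) (i : Fin (N + 1)) :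
    (coordFlag e c i).map g = coordFlag e' c i := by
  rw [coordFlag, coordFlag, Submodule.map_span, Set.image_image]
  simp only [hg]

/-- Permute the pairs of a family, swapping the members of those selected by `s`. -/
def twistPairs {d : ℕ} (π : Equiv.Perm (Fin d)) (s : Fin d → Bool) (e : Fin d × Bool → M) :
    Fin d × Bool → M :=
  fun j => if s j.1 && j.2 then - e (π j.1, !j.2) else e (π j.1, xor (s j.1) j.2)

theorem HypSystem.twistPairs {d : ℕ} {e : Fin d × Bool → M} (he : HypSystem Q e)
    (π : Equiv.Perm (Fin d)) (s : Fin d → Bool) : HypSystem Q (twistPairs π s e) := by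
  rintro ⟨k, b⟩ ⟨l, b'⟩
  by_cases hkl : l = k
  · subst hkl
    cases hs : s l <;> cases b <;> cases b' <;>
      simp [_root_.twistPairs, hs, he _ _, partner, pairSign]
  · cases hs : s l <;> cases hs' : s k <;> cases b <;> cases b' <;>
      simp [_root_.twistPairs, hs, hs', he _ _, partner, hkl]

theorem Adapted.twistPairs {d N : ℕ} {V : Fin (N + 1) → Submodule F M} {e : Fin d × Bool → M}
    {c c' : Fin d → Fin N} (h : Adapted V e c) {π : Equiv.Perm (Fin d)} {s : Fin d → Bool}
    (hc : ∀ k, c' k = revIf (s k) (c (π k))) : Adapted V (twistPairs π s e) c' := by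
  rintro ⟨k, b⟩
  have h₀ := h (π k, false)
  have h₁ := h (π k, true)
  cases hs : s k <;> cases b <;> simp_all [_root_.twistPairs, revIf]

/-- Two pairs of flags adapted to systems of full size whose positions agree up to reordering and
reversal are related by an isometry. -/
theorem exists_isom_of_perm {d N N' : ℕ} (hM : finrank F M = 2 * d) [FiniteDimensional F M]
    (hskew : ∀ u u', Q u u' = - Q u' u)
    {V : Fin (N + 1) → Submodule F M} {V' : Fin (N' + 1) → Submodule F M}
    (hV : SelfDualFlag Q V) (hV' : SelfDualFlag Q V')
    {e f : Fin d × Bool → M} (he : HypSystem Q e) (hf : HypSystem Q f)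
    {c b : Fin d → Fin N} {c' b' : Fin d → Fin N'} (hc : Adapted V e c) (hc' : Adapted V' e c')
    (π : Equiv.Perm (Fin d))
    (h : ∀ k, (b k = c (π k) ∧ b' k = c' (π k)) ∨
      (b k = (c (π k)).rev ∧ b' k = (c' (π k)).rev)) :
    ∃ g : M ≃ₗ[F] M, inIsom Q g ∧
      (∀ i, (V i).map (g : M →ₗ[F] M) = coordFlag f b i) ∧
      (∀ i, (V' i).map (g : M →ₗ[F] M) = coordFlag f b' i) := by
  have h' : ∀ k, ∃ s : Bool, b k = revIf s (c (π k)) ∧ b' k = revIf s (c' (π k)) := fun k =>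
    (h k).elim (fun h => ⟨false, by simpa [revIf] using h⟩)
      fun h => ⟨true, by simpa [revIf] using h⟩
  choose s hs hs' using h'
  have ht := he.twistPairs π s
  obtain ⟨g, hgQ, hg⟩ := ht.exists_isom hM hf
  refine ⟨g, hgQ, fun i => ?_, fun i => ?_⟩
  · rw [(hc.twistPairs hs).eq_coordFlag hM hskew hV ht]
    exact map_coordFlag _ hg _ _
  · rw [(hc'.twistPairs hs').eq_coordFlag hM hskew hV' ht]
    exact map_coordFlag _ hg _ _

theorem exists_hypSystem {d : ℕ} (hM : finrank F M = 2 * d)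
    (hskew : ∀ u u', Q u u' = - Q u' u) (halt : ∀ u, Q u u = 0)
    (hnd : ∀ u, (∀ u', Q u u' = 0) → u = 0) :
    ∃ e : Fin d × Bool → M, HypSystem Q e := by
  have hV : SelfDualFlag Q (N := 1) ![⊥, ⊤] := by
    refine ⟨?_, rfl, rfl, ?_⟩
    · intro i j hij
      fin_cases i
      · exact bot_le
      · fin_cases j
        · exact absurd hij (by decide)
        · exact le_rfl
    · have h₀ : orthB Q ⊤ = ⊥ := by
        ext u
        rw [mem_orthB, Submodule.mem_bot]
        refine ⟨fun h => hnd u fun u' => h u' trivial, ?_⟩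
        rintro rfl
        simp
      have h₁ : orthB Q ⊥ = ⊤ := by
        ext u
        simp [mem_orthB]
      intro i
      fin_cases i
      · exact h₀.symm
      · exact h₁.symm
  obtain ⟨e, _, _, he, _⟩ := exists_adapted_of_le hM hskew halt hV hV d le_rfl
  exact ⟨e, he⟩

/-- The number of members of a family of pairs in a given position of the grid is an invariant of
the dimensions of the intersections of the two coordinate flags. -/
theorem card_position_eq_of_finrank_eq {d N N' : ℕ} (hM : finrank F M = 2 * d)
    [FiniteDimensional F M] {e : Fin d × Bool → M} (he : HypSystem Q e)
    {c b : Fin d → Fin N} {c' b' : Fin d → Fin N'}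
    (h : ∀ i i', finrank F ↥(coordFlag (F := F) e c i ⊓ coordFlag e c' i')
      = finrank F ↥(coordFlag (F := F) e b i ⊓ coordFlag e b' i')) (p : Fin N × Fin N') :
    (Finset.univ.filter fun j : Fin d × Bool =>
        (revIf j.2 (c j.1), revIf j.2 (c' j.1)) = p).card
      = (Finset.univ.filter fun j : Fin d × Bool =>
        (revIf j.2 (b j.1), revIf j.2 (b' j.1)) = p).card := by
  refine card_fiber_eq_of_card_rect_eq (fun j : Fin d × Bool =>
    (revIf j.2 (c j.1), revIf j.2 (c' j.1))) (fun j => (revIf j.2 (b j.1), revIf j.2 (b' j.1)))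
    (fun i i' => ?_) p
  rw [← finrank_coordFlag_inf hM he, ← finrank_coordFlag_inf hM he, h]

end Hyperbolic

/-! ### Positions up to reversal -/

/-- The central symmetry of a grid. -/
def gridRev {N N' : ℕ} (p : Fin N × Fin N') : Fin N × Fin N' := (p.1.rev, p.2.rev)

theorem finProdFinEquiv_gridRev {N N' : ℕ} (p : Fin N × Fin N') :
    finProdFinEquiv (gridRev p) = (finProdFinEquiv p).rev := by
  obtain ⟨a, b⟩ := p
  apply Fin.ext
  simp only [gridRev, finProdFinEquiv_apply_val, Fin.val_rev]
  obtain ⟨x, hx⟩ := Nat.exists_eq_add_of_lt a.2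
  obtain ⟨y, hy⟩ := Nat.exists_eq_add_of_lt b.2
  have h₁ : N - (a.1 + 1) = x := by omega
  have h₂ : N' - (b.1 + 1) = y := by omega
  rw [h₁, h₂]
  refine (Nat.sub_eq_of_eq_add ?_).symm
  generalize a.1 = a at *
  generalize b.1 = b at *
  subst hx hy
  ring

theorem exists_gridClass (n : ℕ) :
    ∃ φ : Fin (2 * n + 1) × Fin (2 * n + 1) → Fin (2 * n ^ 2 + 2 * n + 1),
      Function.Surjective φ ∧ ∀ p q, φ p = φ q ↔ p = q ∨ p = gridRev q := by
  have hN : (2 * n + 1) * (2 * n + 1) = 2 * (2 * n ^ 2 + 2 * n) + 1 := by ring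
  set K := 2 * n ^ 2 + 2 * n
  refine ⟨fun p => ⟨min (finProdFinEquiv p).1 (finProdFinEquiv p).rev.1, ?_⟩, ?_, ?_⟩
  · have := (finProdFinEquiv p).2
    rw [Fin.val_rev]
    omega
  · intro t
    refine ⟨finProdFinEquiv.symm ⟨t.1, by omega⟩, ?_⟩
    apply Fin.ext
    simp only [Equiv.apply_symm_apply, Fin.val_rev]
    omega
  · intro p q
    have h : (p = q ∨ p = gridRev q) ↔ (finProdFinEquiv p = finProdFinEquiv q ∨
        finProdFinEquiv p = (finProdFinEquiv q).rev) := by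
      rw [← finProdFinEquiv_gridRev, finProdFinEquiv.apply_eq_iff_eq,
        finProdFinEquiv.apply_eq_iff_eq]
    rw [h]
    have h₁ := (finProdFinEquiv p).2
    have h₂ := (finProdFinEquiv q).2
    simp only [Fin.ext_iff, Fin.val_rev]
    omega

theorem gridRev_gridRev {N N' : ℕ} (p : Fin N × Fin N') : gridRev (gridRev p) = p := by
  simp [gridRev]

theorem card_position {d N N' : ℕ} (c : Fin d → Fin N × Fin N') (p : Fin N × Fin N') :
    (Finset.univ.filter fun j : Fin d × Bool =>
        (revIf j.2 (c j.1).1, revIf j.2 (c j.1).2) = p).card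
      = (Finset.univ.filter fun k => c k = p).card
        + (Finset.univ.filter fun k => c k = gridRev p).card := by
  have h : ∀ q : Fin N × Fin N', (q.1.rev, q.2.rev) = p ↔ q = gridRev p := fun q =>
    ⟨fun h => by rw [← h]; exact (gridRev_gridRev q).symm, fun h => by
      rw [h]; exact gridRev_gridRev p⟩
  rw [Finset.card_filter, Finset.card_filter, Finset.card_filter, Fintype.sum_prod_type]
  simp only [Fintype.sum_bool, revIf, if_true, Bool.false_eq_true, if_false, h,
    Finset.sum_add_distrib]
  rw [add_comm]

/-- The class counts of a family of positions are determined by its position counts. -/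
theorem card_class_eq_of_card_position_eq {d N N' : ℕ} {T : Type*} [DecidableEq T]
    {φ : Fin N × Fin N' → T} (hφ : ∀ p q, φ p = φ q ↔ p = q ∨ p = gridRev q)
    (hs : Function.Surjective φ) {c b : Fin d → Fin N × Fin N'}
    (h : ∀ p, (Finset.univ.filter fun j : Fin d × Bool =>
        (revIf j.2 (c j.1).1, revIf j.2 (c j.1).2) = p).card
      = (Finset.univ.filter fun j : Fin d × Bool =>
        (revIf j.2 (b j.1).1, revIf j.2 (b j.1).2) = p).card) (t : T) :
    (Finset.univ.filter fun k => φ (c k) = t).card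
      = (Finset.univ.filter fun k => φ (b k) = t).card := by
  obtain ⟨p, rfl⟩ := hs t
  have hp := h p
  rw [card_position, card_position] at hp
  simp only [hφ]
  by_cases hpp : gridRev p = p
  · simp only [hpp, or_self] at hp ⊢
    omega
  · have hd : ∀ a : Fin d → Fin N × Fin N', (Finset.univ.filter fun k => a k = p ∨
        a k = gridRev p).card = (Finset.univ.filter fun k => a k = p).card
        + (Finset.univ.filter fun k => a k = gridRev p).card := by
      intro a
      rw [Finset.filter_or, Finset.card_union_of_disjoint]
      rw [Finset.disjoint_filter]
      intro k _ h₁ h₂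
      exact hpp (h₂.symm.trans h₁)
    rw [hd, hd, hp]

/-- The multiset of values of a family, as an element of the symmetric power. -/
def symOfFamily {d : ℕ} {T : Type*} (f : Fin d → T) : Sym T d :=
  ⟨Finset.univ.val.map f, by simp⟩

theorem symOfFamily_surjective {d : ℕ} {T : Type*} :
    Function.Surjective (symOfFamily : (Fin d → T) → Sym T d) := by
  rintro ⟨s, hs⟩
  obtain ⟨l, rfl⟩ := Quot.exists_rep s
  have hl : l.length = d := hs
  subst hl
  refine ⟨l.get, Subtype.ext ?_⟩
  change Multiset.map l.get Finset.univ.val = _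
  rw [Fin.univ_val_map, List.ofFn_get]
  rfl

theorem symOfFamily_eq_iff {d : ℕ} {T : Type*} [DecidableEq T] (f g : Fin d → T) :
    symOfFamily f = symOfFamily g ↔ ∀ t, (Finset.univ.filter fun k => f k = t).card
      = (Finset.univ.filter fun k => g k = t).card := by
  have h : ∀ (f : Fin d → T) t, Multiset.count t (Finset.univ.val.map f)
      = (Finset.univ.filter fun k => f k = t).card := by
    intro f t
    rw [Multiset.count_map, Finset.card_def, Finset.filter_val]
    simp only [eq_comm]
  refine Subtype.ext_iff.trans ?_
  rw [Multiset.ext]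
  exact forall_congr' fun t => by rw [← h, ← h]; rfl

/-! ### Orbits -/

section Orbits

variable {F : Type} [Field F] {n d : ℕ}
  {Q : (Fin (2 * d) → F) →ₗ[F] (Fin (2 * d) → F) →ₗ[F] F}

theorem XCflag.selfDualFlag (V : XCflag n d F Q) : SelfDualFlag Q V.1 :=
  ⟨V.2.1, V.2.2.1, V.2.2.2.1, V.2.2.2.2⟩

theorem YCflag.selfDualFlag (V : YCflag d F Q) : SelfDualFlag Q V.1 :=
  ⟨V.2.1, V.2.2.1, V.2.2.2.1, V.2.2.2.2.2⟩

/-- The coordinate flag as a point of `'X_C`. -/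
def XCflag.ofPositions {e : Fin d × Bool → Fin (2 * d) → F} (he : HypSystem Q e)
    (c : Fin d → Fin (2 * n + 1)) : XCflag n d F Q :=
  ⟨coordFlag e c, let h := selfDualFlag_coordFlag (by simp) he c
    ⟨h.mono, h.zero, h.last, h.dual⟩⟩

/-- The first `d` of the `2 * d` positions in a complete flag. -/
def firstHalf (k : Fin d) : Fin (2 * d) := Fin.castLE (by omega) k

theorem card_revIf_firstHalf_lt (i : Fin (2 * d + 1)) :
    (Finset.univ.filter fun j : Fin d × Bool =>
      (revIf j.2 (firstHalf j.1)).castSucc < i).card = i := by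
  have hinj : Function.Injective fun j : Fin d × Bool => revIf j.2 (firstHalf j.1) := by
    rintro ⟨k, b⟩ ⟨l, b'⟩ h
    have hk := k.2
    have hl := l.2
    cases b <;> cases b' <;> simp [revIf, firstHalf, Fin.ext_iff] at h ⊢ <;> omega
  have hbij : Function.Bijective fun j : Fin d × Bool => revIf j.2 (firstHalf j.1) :=
    (Fintype.bijective_iff_injective_and_card _).mpr ⟨hinj, by simp [mul_comm]⟩
  have h₁ : (Finset.univ.filter fun j : Fin d × Bool =>
      (revIf j.2 (firstHalf j.1)).castSucc < i).card
      = (Finset.univ.filter fun t : Fin (2 * d) => t.castSucc < i).card := by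
    simp only [Finset.card_filter]
    exact hbij.sum_comp fun t : Fin (2 * d) => if t.castSucc < i then 1 else 0
  rw [h₁]
  have h₂ := Fin.card_filter_val_lt (n := 2 * d) (m := i.1)
  simp only [Fin.lt_def, Fin.val_castSucc]
  rw [h₂]
  omega

/-- The standard complete flag of a hyperbolic system. -/
def YCflag.standard {e : Fin d × Bool → Fin (2 * d) → F} (he : HypSystem Q e) : YCflag d F Q :=
  ⟨coordFlag e firstHalf, let h := selfDualFlag_coordFlag (by simp) he firstHalf
    ⟨h.mono, h.zero, h.last, fun i => by
      rw [finrank_coordFlag (by simp) he, card_revIf_firstHalf_lt], h.dual⟩⟩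

theorem finrank_inf_eq_of_map_eq {M : Type} [AddCommGroup M] [Module F M] (g : M ≃ₗ[F] M)
    {V V' W W' : Submodule F M} (h : V.map (g : M →ₗ[F] M) = W)
    (h' : V'.map (g : M →ₗ[F] M) = W') : finrank F ↥(V ⊓ V') = finrank F ↥(W ⊓ W') := by
  rw [← h, ← h', ← Submodule.map_inf _ g.injective]
  exact (LinearEquiv.finrank_map_eq g _).symm

theorem finrank_inf_eq_of_quot_relXX_eq {p p' : XCflag n d F Q × XCflag n d F Q}
    (h : Quot.mk (relXX n d F Q) p = Quot.mk (relXX n d F Q) p') (i i') :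
    finrank F ↥(p.1.1 i ⊓ p.2.1 i') = finrank F ↥(p'.1.1 i ⊓ p'.2.1 i') :=
  congrArg (Quot.lift (fun p : XCflag n d F Q × XCflag n d F Q =>
    finrank F ↥(p.1.1 i ⊓ p.2.1 i'))
    fun _ _ ⟨g, _, h₁, h₂⟩ => finrank_inf_eq_of_map_eq g (h₁ i) (h₂ i')) h

theorem finrank_inf_eq_of_quot_relXY_eq {p p' : XCflag n d F Q × YCflag d F Q}
    (h : Quot.mk (relXY n d F Q) p = Quot.mk (relXY n d F Q) p') (i i') :
    finrank F ↥(p.1.1 i ⊓ p.2.1 i') = finrank F ↥(p'.1.1 i ⊓ p'.2.1 i') :=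
  congrArg (Quot.lift (fun p : XCflag n d F Q × YCflag d F Q =>
    finrank F ↥(p.1.1 i ⊓ p.2.1 i'))
    fun _ _ ⟨g, _, h₁, h₂⟩ => finrank_inf_eq_of_map_eq g (h₁ i) (h₂ i')) h

theorem card_quot_relXX (hskew : ∀ u u', Q u u' = - Q u' u) (halt : ∀ u, Q u u = 0)
    (hnd : ∀ u, (∀ u', Q u u' = 0) → u = 0) :
    Nat.card (Quot (relXX n d F Q)) = Nat.choose (2 * n ^ 2 + 2 * n + d) d := by
  have hM : finrank F (Fin (2 * d) → F) = 2 * d := by simp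
  obtain ⟨e, he⟩ := exists_hypSystem hM hskew halt hnd
  obtain ⟨φ, hφs, hφ⟩ := exists_gridClass n
  have hcard : Nat.card (Sym (Fin (2 * n ^ 2 + 2 * n + 1)) d)
      = Nat.choose (2 * n ^ 2 + 2 * n + d) d := by
    rw [Nat.card_eq_fintype_card, Sym.card_sym_eq_choose, Fintype.card_fin]
    congr 1
    omega
  rw [← hcard]
  refine Nat.card_eq_of_surjective_of_ker_eq
    (A := Fin d → Fin (2 * n + 1) × Fin (2 * n + 1))
    (fun c => Quot.mk _ (XCflag.ofPositions he fun k => (c k).1,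
      XCflag.ofPositions he fun k => (c k).2))
    (fun c => symOfFamily (φ ∘ c)) ?_ (symOfFamily_surjective.comp hφs.comp_left) ?_
  · rintro ⟨V, V'⟩
    obtain ⟨f, c, c', hf, hc, hc'⟩ :=
      exists_adapted_of_le hM hskew halt V.selfDualFlag V'.selfDualFlag d le_rfl
    refine ⟨fun k => (c k, c' k), (Quot.sound ?_).symm⟩
    exact exists_isom_of_perm hM hskew V.selfDualFlag V'.selfDualFlag hf he hc hc'
      (Equiv.refl _) fun k => Or.inl ⟨rfl, rfl⟩
  · intro c b
    rw [symOfFamily_eq_iff]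
    constructor
    · intro h
      have hi := finrank_inf_eq_of_quot_relXX_eq h
      have hd : ∀ i i', finrank F ↥(coordFlag (F := F) e (fun k => (c k).1) i ⊓
          coordFlag e (fun k => (c k).2) i') = finrank F ↥(coordFlag (F := F) e
          (fun k => (b k).1) i ⊓ coordFlag e (fun k => (b k).2) i') :=
        fun i i' => hi i i'
      exact card_class_eq_of_card_position_eq hφ hφs (card_position_eq_of_finrank_eq hM he hd)
    · intro h
      obtain ⟨π, hπ⟩ := exists_perm_of_card_fiber_eq _ _ h
      obtain ⟨g, hg, h₁, h₂⟩ := exists_isom_of_perm hM hskew (selfDualFlag_coordFlag hM he _)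
        (selfDualFlag_coordFlag hM he _) he he (adapted_coordFlag e fun k => (b k).1)
        (adapted_coordFlag e fun k => (b k).2) (b := fun k => (c k).1) (b' := fun k => (c k).2) π
        fun k => by simpa only [Prod.ext_iff, gridRev] using (hφ _ _).mp (hπ k).symm
      exact (Quot.sound ⟨g, hg, fun i => h₁ i, fun i => h₂ i⟩).symm

theorem card_quot_relXY (hskew : ∀ u u', Q u u' = - Q u' u) (halt : ∀ u, Q u u = 0)
    (hnd : ∀ u, (∀ u', Q u u' = 0) → u = 0) :
    Nat.card (Quot (relXY n d F Q)) = (2 * n + 1) ^ d := by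
  have hM : finrank F (Fin (2 * d) → F) = 2 * d := by simp
  obtain ⟨e, he⟩ := exists_hypSystem hM hskew halt hnd
  have hcard : Nat.card (Fin d → Fin (2 * n + 1)) = (2 * n + 1) ^ d := by simp
  rw [← hcard]
  symm
  refine Nat.card_eq_of_bijective (fun c => Quot.mk _ (XCflag.ofPositions he c,
    YCflag.standard he)) ⟨?_, ?_⟩
  · intro c b h
    funext k
    have hi := finrank_inf_eq_of_quot_relXY_eq h
    have hd : ∀ i i', finrank F ↥(coordFlag (F := F) e c i ⊓ coordFlag e firstHalf i')
        = finrank F ↥(coordFlag (F := F) e b i ⊓ coordFlag e firstHalf i') :=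
      fun i i' => hi i i'
    have hp := card_position_eq_of_finrank_eq hM he hd (c k, firstHalf k)
    have hpos : 0 < (Finset.univ.filter fun j : Fin d × Bool =>
        (revIf j.2 (c j.1), revIf j.2 (firstHalf j.1)) = (c k, firstHalf k)).card :=
      Finset.card_pos.mpr ⟨(k, false), by simp [revIf]⟩
    rw [hp, Finset.card_pos] at hpos
    obtain ⟨⟨l, s⟩, hl⟩ := hpos
    rw [Finset.mem_filter, Prod.mk.injEq] at hl
    obtain ⟨-, h₁, h₂⟩ := hl
    have hk := k.2
    have hl := l.2
    cases s
    · have hlk : l = k := by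
        simpa [revIf, firstHalf, Fin.ext_iff] using h₂
      rw [← hlk] at h₁ ⊢
      exact h₁.symm
    · simp [revIf, firstHalf, Fin.ext_iff] at h₂
      omega
  · rintro ⟨V, V'⟩
    obtain ⟨f, c, c', hf, hc, hc'⟩ :=
      exists_adapted_of_le hM hskew halt V.selfDualFlag V'.selfDualFlag d le_rfl
    have hdim : ∀ i, (Finset.univ.filter fun j : Fin d × Bool =>
        (revIf j.2 (c' j.1)).castSucc < i).card = (i : ℕ) := by
      intro i
      rw [← finrank_coordFlag hM hf, ← hc'.eq_coordFlag hM hskew V'.selfDualFlag hf]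
      exact V'.2.2.2.2.1 i
    have hex : ∀ k : Fin (2 * d), ∃ j : Fin d × Bool, revIf j.2 (c' j.1) = k := by
      intro k
      by_contra! hne
      have h₁ := hdim k.castSucc
      have h₂ := hdim k.succ
      have : (Finset.univ.filter fun j : Fin d × Bool =>
          (revIf j.2 (c' j.1)).castSucc < k.castSucc)
          = Finset.univ.filter fun j => (revIf j.2 (c' j.1)).castSucc < k.succ := by
        refine Finset.filter_congr fun j _ => ?_
        have := hne j
        rw [Ne, Fin.ext_iff] at this
        simp only [Fin.lt_def, Fin.val_castSucc, Fin.val_succ]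
        omega
      rw [this, h₂] at h₁
      simp at h₁
    choose j hj using fun k : Fin d => hex (firstHalf k)
    have hinj : Function.Injective fun k => (j k).1 := by
      intro k l hkl
      have hk := hj k
      have hl := hj l
      have hkl' : (j k).1 = (j l).1 := hkl
      rw [hkl'] at hk
      have h₁ := k.2
      have h₂ := l.2
      cases hbk : (j k).2 <;> cases hbl : (j l).2 <;>
        simp [hbk, hbl, revIf, firstHalf, Fin.ext_iff] at hk hl ⊢ <;> omega
    refine ⟨fun k => revIf (j k).2 (c (j k).1), (Quot.sound ?_).symm⟩
    obtain ⟨g, hg, h₁, h₂⟩ := exists_isom_of_perm hM hskew V.selfDualFlag V'.selfDualFlag hf he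
      hc hc' (b := fun k => revIf (j k).2 (c (j k).1)) (b' := firstHalf)
      (Equiv.ofBijective _ (Finite.injective_iff_bijective.mp hinj)) fun k => by
        rw [← hj k]
        cases (j k).2
        · exact Or.inl ⟨rfl, rfl⟩
        · exact Or.inr ⟨rfl, rfl⟩
    exact ⟨g, hg, fun i => h₁ i, fun i => h₂ i⟩

end Orbits

/-- The number of `Sp(D)`-orbits on `'X_C × 'X_C` is `C(2n²+2n+d, d)`, and the number of
`Sp(D)`-orbits on `'X_C × Y_C` is `(2n+1)^d`. -/
theorem stmt17 (n d : ℕ) (hn : 0 < n) (hd : 0 < d)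
    (F : Type) [Field F] [Fintype F] (hodd : Odd (Fintype.card F))
    (Q : (Fin (2*d) → F) →ₗ[F] (Fin (2*d) → F) →ₗ[F] F)
    (hQskew : ∀ u u', Q u u' = - Q u' u) (hQalt : ∀ u, Q u u = 0)
    (hQnd : ∀ u, (∀ u', Q u u' = 0) → u = 0) :
    Nat.card (Quot (relXX n d F Q)) = Nat.choose (2*n^2 + 2*n + d) d
    ∧ Nat.card (Quot (relXY n d F Q)) = (2*n+1) ^ d := by
  exact ⟨card_quot_relXX hQskew hQalt hQnd, card_quot_relXY hQskew hQalt hQnd⟩
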